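/- Let X be a simple graph on a vertex set V that is connected, acyclic (a tree) and locally finite, with vertex set partitioned as V = V₀ ∪ V₁ where every vertex in V₀ has degree k₀, every vertex in V₁ has degree k₁ (k₀, k₁ positive integers), and every edge joins V₀ to V₁. For n ∈ ℕ define the sphere operator on functions f : V → ℂ by (S_n f)(x) = ∑_{y : d(x,y) = n} f(y), where d is the graph distance. Then for every f : V → ℂ and every x ∈ V₀: (i) (S₂(S₂ f))(x) = (S₄ f)(x) + k₀·(k₁ − 1)·f(x) + (k₁ − 2)·(S₂ f)(x); and (ii) for every n ≥ 2, (S₂(S_{2n} f))(x) = (S_{2n+2} f)(x) + (k₀ − 1)·(k₁ − 1)·(S_{2n−2} f)(x) + (k₁ − 2)·(S_{2n} f)(x). -/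

import Mathlib

/-- Every neighbour of `x` changes the distance to `z` by exactly one. -/
theorem aux_step {V : Type*} {G : SimpleGraph V} (hT : G.IsTree) {x y : V} (z : V)
    (h : G.Adj x y) : G.dist x z = G.dist y z + 1 ∨ G.dist y z = G.dist x z + 1 := by
  have := hT.dist_eq_dist_add_one_of_adj z h
  rwa [G.dist_comm (u := z) (v := x), G.dist_comm (u := z) (v := y)] at this

/-- The first vertex on the geodesic from `x` to `z` is the unique closer neighbour. -/
theorem aux_unique {V : Type*} {G : SimpleGraph V} (hT : G.IsTree) {x z : V} (h : x ≠ z) :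
    ∃ y, G.Adj x y ∧ G.dist x z = G.dist y z + 1 ∧
      ∀ y', G.Adj x y' → G.dist x z = G.dist y' z + 1 → y' = y := by
  obtain ⟨p, hp, hl⟩ := hT.connected.exists_path_of_dist x z
  cases p with
  | nil => exact absurd rfl h
  | @cons _ y _ hxy q =>
    refine ⟨y, hxy, ?_, ?_⟩
    · have h1 := G.dist_le q
      rw [SimpleGraph.Walk.length_cons] at hl
      rcases aux_step hT z hxy with h2 | h2 <;> omega
    · intro y' hy' hd
      obtain ⟨q', hq'⟩ := hT.connected.exists_walk_length_eq_dist y' z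
      have hp' : (SimpleGraph.Walk.cons hy' q').IsPath := by
        apply SimpleGraph.Walk.isPath_of_length_eq_dist
        rw [SimpleGraph.Walk.length_cons]; omega
      have := hT.isAcyclic.path_unique ⟨_, hp⟩ ⟨_, hp'⟩
      have h3 := congrArg (fun r : G.Path x z => r.1.snd) this
      simpa using h3.symm

theorem aux_sphere_finite {V : Type*} {G : SimpleGraph V} (hT : G.IsTree)
    (hlf : ∀ v : V, (G.neighborSet v).Finite) (n : ℕ) :
    ∀ x, {y : V | G.dist x y = n}.Finite := by
  induction n with
  | zero =>
    intro x
    refine (Set.finite_singleton x).subset fun y hy => ?_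
    exact (hT.connected.dist_eq_zero_iff.1 hy).symm
  | succ n ih =>
    intro x
    refine ((hlf x).biUnion fun y _ => ih y).subset fun z hz => ?_
    have hz' : G.dist x z = n + 1 := hz
    have hne : x ≠ z := by
      rintro rfl
      simp at hz'
    obtain ⟨y, hy, hd, -⟩ := aux_unique hT hne
    simp only [Set.mem_iUnion]
    exact ⟨y, hy, show G.dist y z = n by omega⟩

open Classical in
/-- Number of neighbours of `x` at distance `n` from `z`. -/
theorem aux_count {V : Type*} {G : SimpleGraph V} (hT : G.IsTree)
    (hlf : ∀ v : V, (G.neighborSet v).Finite) (n : ℕ) (hn : 1 ≤ n) (x z : V) (k : ℕ)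
    (hk : (hlf x).toFinset.card = k) :
    (∑ y ∈ (hlf x).toFinset, if G.dist y z = n then (1 : ℂ) else 0) =
      (if G.dist x z = n + 1 then 1 else 0) +
      (if n = 1 then (k : ℂ) else (k : ℂ) - 1) * (if G.dist x z = n - 1 then 1 else 0) := by
  by_cases hxz : x = z
  · subst hxz
    have h1 : ∀ y ∈ (hlf x).toFinset, (if G.dist y x = n then (1 : ℂ) else 0)
        = if n = 1 then 1 else 0 := by
      intro y hy
      have hy' : G.Adj x y := by simpa using hy
      have : G.dist y x = 1 := SimpleGraph.dist_eq_one_iff_adj.2 hy'.symm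
      rw [this]
      simp only [eq_comm]
    rw [Finset.sum_congr rfl h1, Finset.sum_const, hk]
    by_cases h : n = 1
    · simp [h]
    · have : ¬ (0 = n - 1) := by omega
      simp [h, this]
  · obtain ⟨y₀, hy₀, hd, hu⟩ := aux_unique hT hxz
    have hmem : y₀ ∈ (hlf x).toFinset := by simpa using hy₀
    rw [← Finset.add_sum_erase _ _ hmem]
    have h1 : ∀ y ∈ (hlf x).toFinset.erase y₀, (if G.dist y z = n then (1 : ℂ) else 0)
        = if G.dist x z = n - 1 then 1 else 0 := by
      intro y hy
      rw [Finset.mem_erase] at hy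
      have hy' : G.Adj x y := by simpa using hy.2
      have : G.dist y z = G.dist x z + 1 := by
        rcases aux_step hT z hy' with h | h
        · exact absurd (hu y hy' h) hy.1
        · exact h
      have e : (G.dist y z = n) ↔ (G.dist x z = n - 1) := by omega
      simp only [e]
    rw [Finset.sum_congr rfl h1, Finset.sum_const, Finset.card_erase_of_mem hmem, hk]
    have hkpos : 1 ≤ k := by
      rw [← hk]; exact Finset.card_pos.2 ⟨_, hmem⟩
    have e : (G.dist y₀ z = n) ↔ (G.dist x z = n + 1) := by omega
    simp only [e, nsmul_eq_mul]
    rw [Nat.cast_sub hkpos]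
    by_cases h : n = 1
    · have : ¬ (G.dist x z = n - 1) := by omega
      simp [this]
    · simp [h]

open Classical in
theorem aux_tsum {V : Type*} {G : SimpleGraph V} (f : V → ℂ) (n : ℕ) (x : V) (T : Finset V)
    (hT : ∀ y, G.dist x y = n → y ∈ T) :
    (∑' y : {y : V | G.dist x y = n}, f y.1) = ∑ z ∈ T, if G.dist x z = n then f z else 0 := by
  rw [tsum_subtype {y : V | G.dist x y = n} f, tsum_eq_sum (s := T)]
  · refine Finset.sum_congr rfl fun b _ => ?_
    simp only [Set.indicator_apply, Set.mem_setOf_eq]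
  · intro b hb
    apply Set.indicator_of_notMem
    exact fun h => hb (hT b h)

theorem aux_rec {V : Type*} {G : SimpleGraph V} (hT : G.IsTree)
    (hlf : ∀ v : V, (G.neighborSet v).Finite) (S : ℕ → (V → ℂ) → (V → ℂ))
    (hS : ∀ (n : ℕ) (g : V → ℂ) (x : V),
      S n g x = ∑' y : {y : V | G.dist x y = n}, g y.1)
    (f : V → ℂ) (n : ℕ) (hn : 1 ≤ n) (x : V) (k : ℕ) (hk : (hlf x).toFinset.card = k) :
    ∑ y ∈ (hlf x).toFinset, S n f y =
      S (n + 1) f x + (if n = 1 then (k : ℂ) else (k : ℂ) - 1) * S (n - 1) f x := by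
  classical
  have hfin := aux_sphere_finite hT hlf
  let T : Finset V := (hfin (n + 1) x).toFinset ∪ (hfin (n - 1) x).toFinset ∪
    (hlf x).toFinset.biUnion fun y => (hfin n y).toFinset
  have h1 : ∀ y ∈ (hlf x).toFinset,
      S n f y = ∑ z ∈ T, if G.dist y z = n then f z else 0 := by
    intro y hy
    rw [hS]
    apply aux_tsum
    intro z hz
    refine Finset.mem_union_right _ (Finset.mem_biUnion.2 ⟨y, hy, ?_⟩)
    simpa using hz
  rw [Finset.sum_congr rfl h1, Finset.sum_comm, hS, hS,
    aux_tsum f (n + 1) x T (fun z hz => Finset.mem_union_left _ (Finset.mem_union_left _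
      (by simpa using hz))),
    aux_tsum f (n - 1) x T (fun z hz => Finset.mem_union_left _ (Finset.mem_union_right _
      (by simpa using hz))), Finset.mul_sum, ← Finset.sum_add_distrib]
  refine Finset.sum_congr rfl fun z _ => ?_
  have h2 := congrArg (· * f z) (aux_count hT hlf n hn x z k hk)
  simp only [Finset.sum_mul, add_mul, mul_assoc, ite_mul, one_mul, zero_mul] at h2
  rw [h2]
  split_ifs <;> ring

theorem stmt8 {V : Type*} (G : SimpleGraph V)
    (hconn : G.Connected) (hacyclic : G.IsAcyclic)
    (hlf : ∀ v : V, (G.neighborSet v).Finite)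
    (k₀ k₁ : ℕ) (hk₀ : 0 < k₀) (hk₁ : 0 < k₁)
    (V₀ V₁ : Set V) (hcover : V₀ ∪ V₁ = Set.univ) (hdisj : V₀ ∩ V₁ = ∅)
    (hdeg₀ : ∀ x ∈ V₀, (hlf x).toFinset.card = k₀)
    (hdeg₁ : ∀ x ∈ V₁, (hlf x).toFinset.card = k₁)
    (hbip : ∀ x y : V, G.Adj x y → (x ∈ V₀ ∧ y ∈ V₁) ∨ (x ∈ V₁ ∧ y ∈ V₀))
    (S : ℕ → (V → ℂ) → (V → ℂ))
    (hS : ∀ (n : ℕ) (g : V → ℂ) (x : V),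
      S n g x = ∑' y : {y : V | G.dist x y = n}, g y.1)
    (f : V → ℂ) (x : V) (hx : x ∈ V₀) :
    (S 2 (S 2 f) x =
        S 4 f x + (k₀ : ℂ) * ((k₁ : ℂ) - 1) * f x + ((k₁ : ℂ) - 2) * S 2 f x) ∧
      ∀ n : ℕ, 2 ≤ n →
        S 2 (S (2 * n) f) x =
          S (2 * n + 2) f x + ((k₀ : ℂ) - 1) * ((k₁ : ℂ) - 1) * S (2 * n - 2) f x +
            ((k₁ : ℂ) - 2) * S (2 * n) f x := by
  have hT : G.IsTree := ⟨hconn, hacyclic⟩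
  have hrec := aux_rec hT hlf S hS
  have hS1 : ∀ (g : V → ℂ) (y : V), S 1 g y = ∑ z ∈ (hlf y).toFinset, g z := by
    intro g y
    classical
    rw [hS, aux_tsum g 1 y (hlf y).toFinset]
    · refine Finset.sum_congr rfl fun z hz => ?_
      have : G.Adj y z := by simpa using hz
      rw [if_pos (SimpleGraph.dist_eq_one_iff_adj.2 this)]
    · intro z hz
      simpa using SimpleGraph.dist_eq_one_iff_adj.1 hz
  have hS0 : ∀ (g : V → ℂ) (y : V), S 0 g y = g y := by
    intro g y
    classical
    rw [hS, aux_tsum g 0 y {y}]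
    · simp
    · intro z hz
      simpa using (hconn.dist_eq_zero_iff.1 hz).symm
  have hN : ∀ y ∈ (hlf x).toFinset, (hlf y).toFinset.card = k₁ := by
    intro y hy
    have hxy : G.Adj x y := by simpa using hy
    rcases hbip x y hxy with h | h
    · exact hdeg₁ y h.2
    · have : x ∈ V₀ ∩ V₁ := ⟨hx, h.1⟩
      rw [hdisj] at this
      exact this.elim
  have hS2 : ∀ g : V → ℂ, S 2 g x =
      ∑ y ∈ (hlf x).toFinset, ∑ z ∈ (hlf y).toFinset, g z - k₀ * g x := by
    intro g
    have h := hrec g 1 le_rfl x k₀ (hdeg₀ x hx)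
    simp only [hS1, hS0, if_true, Nat.sub_self, Nat.reduceAdd] at h
    rw [h]; ring
  have key : ∀ m, 2 ≤ m → S 2 (S m f) x = S (m + 2) f x
      + (if m = 2 then (k₀ : ℂ) else (k₀ : ℂ) - 1) * ((k₁ : ℂ) - 1) * S (m - 2) f x
      + ((k₁ : ℂ) - 2) * S m f x := by
    intro m hm
    rw [hS2]
    have h1 : ∀ y ∈ (hlf x).toFinset, ∑ z ∈ (hlf y).toFinset, S m f z =
        S (m + 1) f y + ((k₁ : ℂ) - 1) * S (m - 1) f y := by
      intro y hy
      have h := hrec f m (by omega) y k₁ (hN y hy)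
      rwa [if_neg (by omega)] at h
    rw [Finset.sum_congr rfl h1, Finset.sum_add_distrib, ← Finset.mul_sum,
      hrec f (m + 1) (by omega) x k₀ (hdeg₀ x hx), hrec f (m - 1) (by omega) x k₀ (hdeg₀ x hx),
      if_neg (by omega : ¬ (m + 1 = 1))]
    have e1 : m - 1 + 1 = m := by omega
    have e2 : m - 1 - 1 = m - 2 := by omega
    have e3 : (m - 1 = 1) ↔ m = 2 := by omega
    simp only [e1, e2, e3, Nat.add_sub_cancel]
    ring
  refine ⟨?_, fun n hn => ?_⟩
  · have := key 2 le_rfl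
    simpa [hS0] using this
  · have := key (2 * n) (by omega)
    rwa [if_neg (by omega)] at this
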